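/- Let G₁ and G₂ be groups and let g be an element of the free product G₁ ∗ G₂ that lies neither in the image of inl : G₁ → G₁ ∗ G₂ nor in the image of inr : G₂ → G₁ ∗ G₂. Then the intersection of the centralizer of g with the image of inl is the trivial subgroup, and likewise the intersection of the centralizer of g with the image of inr is the trivial subgroup. -/

import Mathlib

open Monoid

universe u v

namespace Monoid.CoprodI

variable {ι : Type*} {G : ι → Type*} [∀ i, Group (G i)]

namespace Word

variable [DecidableEq ι] [∀ i, DecidableEq (G i)]

theorem fstIdx_of_smul {i : ι} {m : G i} (hm : m ≠ 1) {w : Word G} (hw : w.fstIdx ≠ some i) :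
    ((of m : CoprodI G) • w).fstIdx = some i := by
  rw [← cons_eq_smul (h1 := hw) (h2 := hm), fstIdx_cons]

theorem fstIdx_of_smul_empty_ne {i k : ι} (hik : k ≠ i) (m : G i) :
    ((of m : CoprodI G) • (empty : Word G)).fstIdx ≠ some k := by
  by_cases hm : m = 1
  · simp [hm, fstIdx, empty]
  · rw [fstIdx_of_smul hm (by simp [fstIdx, empty])]
    simpa using hik.symm

/-- Right multiplication by an element of the factor `G i` does not change the factor of the first
letter of a reduced word, unless the word represents an element of `G i`. -/
theorem fstIdx_prod_mul_of_smul_empty {i : ι} (x : G i) (w : Word G) :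
    ((w.prod * of x) • (empty : Word G)).fstIdx = w.fstIdx ∨
      w.prod ∈ (of : G i →* CoprodI G).range := by
  induction w using consRecOn with
  | empty => exact Or.inr (by simp [one_mem])
  | cons k b w hw hb ih =>
    rw [prod_cons, fstIdx_cons, mul_assoc, mul_smul]
    rcases ih with ih | ⟨y, hy⟩
    · exact Or.inl (fstIdx_of_smul hb (ih ▸ hw))
    · by_cases hk : k = i
      · subst hk
        exact Or.inr ⟨b * y, by rw [map_mul, hy]⟩
      · refine Or.inl (fstIdx_of_smul hb ?_)
        rw [← hy, ← map_mul]
        exact fstIdx_of_smul_empty_ne hk _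

end Word

/-- The centralizer of a nontrivial element of a factor of a free product is contained in that
factor. -/
theorem mem_range_of_of_commute {i : ι} {x : G i} (hx : x ≠ 1) {g : CoprodI G}
    (h : Commute (of x) g) : g ∈ (of : G i →* CoprodI G).range := by
  classical
  let p := Word.equivPair i (Word.equiv g)
  have hg : g = of p.head * p.tail.prod := by
    rw [← Word.prod_rcons, ← Word.equivPair_symm, Equiv.symm_apply_apply]
    exact (Word.equiv.symm_apply_apply g).symm
  have hconj : of (p.head⁻¹ * x * p.head) * p.tail.prod = p.tail.prod * of x := by
    have h' := h.eq
    rw [hg] at h'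
    simp only [map_mul, map_inv, mul_assoc] at h' ⊢
    rw [h', inv_mul_cancel_left]
  have htail : p.tail.prod • (Word.empty : Word G) = p.tail := Word.equiv.apply_symm_apply p.tail
  suffices p.tail.prod ∈ (of : G i →* CoprodI G).range by
    rw [hg]
    exact mul_mem ⟨_, rfl⟩ this
  refine (Word.fstIdx_prod_mul_of_smul_empty x p.tail).resolve_left fun hidx => ?_
  have hy : p.head⁻¹ * x * p.head ≠ 1 := fun hy =>
    hx (conj_eq_one_iff (a := p.head⁻¹).1 (by rwa [inv_inv]))
  rw [← hconj, mul_smul, htail, Word.fstIdx_of_smul hy p.fstIdx_ne] at hidx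
  exact p.fstIdx_ne hidx.symm

end Monoid.CoprodI

namespace Monoid.Coprod

/-- Two types in possibly different universes, as a family indexed by `Bool`. -/
def BoolFamily (G : Type u) (H : Type v) : Bool → Type (max u v)
  | true => ULift.{v} G
  | false => ULift.{u} H

instance (G : Type u) (H : Type v) [Group G] [Group H] : ∀ b, Group (BoolFamily G H b)
  | true => inferInstanceAs (Group (ULift.{v} G))
  | false => inferInstanceAs (Group (ULift.{u} H))

variable {G : Type u} {H : Type v} [Group G] [Group H]

/-- The canonical map from the binary free product to the indexed free product. -/
def toCoprodI : Coprod G H →* CoprodI (BoolFamily G H) :=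
  lift
    ((CoprodI.of (i := true)).comp
      (MulEquiv.ulift.symm.toMonoidHom : G →* BoolFamily G H true))
    ((CoprodI.of (i := false)).comp
      (MulEquiv.ulift.symm.toMonoidHom : H →* BoolFamily G H false))

/-- The canonical map from the indexed free product to the binary free product. -/
def ofCoprodI : CoprodI (BoolFamily G H) →* Coprod G H :=
  CoprodI.lift fun
    | true => inl.comp (MulEquiv.ulift.toMonoidHom : BoolFamily G H true →* G)
    | false => inr.comp (MulEquiv.ulift.toMonoidHom : BoolFamily G H false →* H)

theorem ofCoprodI_toCoprodI (g : Coprod G H) : ofCoprodI (toCoprodI g) = g := by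
  have : (ofCoprodI.comp toCoprodI : Coprod G H →* Coprod G H) = MonoidHom.id _ :=
    hom_ext rfl rfl
  exact DFunLike.congr_fun this g

theorem mem_range_inl_of_commute {x : G} (hx : x ≠ 1) {g : Coprod G H}
    (h : Commute (inl x) g) : g ∈ (inl : G →* Coprod G H).range := by
  have hx' : (ULift.up x : BoolFamily G H true) ≠ 1 := fun h1 => hx (congrArg ULift.down h1)
  obtain ⟨y, hy⟩ := CoprodI.mem_range_of_of_commute hx' (h.map toCoprodI)
  refine ⟨ULift.down y, ?_⟩
  rw [← ofCoprodI_toCoprodI g, ← hy]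
  rfl

theorem mem_range_inr_of_commute {x : H} (hx : x ≠ 1) {g : Coprod G H}
    (h : Commute (inr x) g) : g ∈ (inr : H →* Coprod G H).range := by
  obtain ⟨y, hy⟩ := mem_range_inl_of_commute hx (h.map (swap G H))
  exact ⟨y, swap_injective hy⟩

end Monoid.Coprod

/-- Let `G₁`, `G₂` be groups and `g` an element of the free product `G₁ ∗ G₂`
lying neither in the image of `inl` nor in the image of `inr`. Then the intersection of the
centralizer of `g` with the image of `inl` is trivial, and likewise for `inr`. -/
theorem centralizer_inf_inl_inr_range_eq_bot
    (G₁ G₂ : Type*) [Group G₁] [Group G₂] (g : Coprod G₁ G₂)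
    (hg₁ : g ∉ (Coprod.inl : G₁ →* Coprod G₁ G₂).range)
    (hg₂ : g ∉ (Coprod.inr : G₂ →* Coprod G₁ G₂).range) :
    Subgroup.centralizer ({g} : Set (Coprod G₁ G₂)) ⊓
        (Coprod.inl : G₁ →* Coprod G₁ G₂).range = ⊥ ∧
      Subgroup.centralizer ({g} : Set (Coprod G₁ G₂)) ⊓
        (Coprod.inr : G₂ →* Coprod G₁ G₂).range = ⊥ := by
  constructor
  · rw [Subgroup.eq_bot_iff_forall]
    rintro _ ⟨hc, x, rfl⟩
    by_contra hx
    exact hg₁ (Coprod.mem_range_inl_of_commute (fun h => hx (by rw [h, map_one]))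
      (Subgroup.mem_centralizer_singleton_iff.1 hc))
  · rw [Subgroup.eq_bot_iff_forall]
    rintro _ ⟨hc, x, rfl⟩
    by_contra hx
    exact hg₂ (Coprod.mem_range_inr_of_commute (fun h => hx (by rw [h, map_one]))
      (Subgroup.mem_centralizer_singleton_iff.1 hc))
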